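/- arXiv:1412.4527 — 4 statements merged into one kernel-verified Lean document; each statement's English description precedes it below -/
import Mathlib

section
/- Let T > 0 and let P : C[0,T] → C[0,T] be an operator such that for some constant M > 0 one has |P[q₁](t) − P[q₂](t)| ≤ M · max_{τ∈[0,t]} |q₁(τ) − q₂(τ)| for all q₁, q₂ ∈ C[0,T] and all t ∈ [0,T], and such that for every constant c ≥ 0 the operator I + cP (where I is the identity) is a bijection of C[0,T] whose inverse satisfies |(I + cP)⁻¹[w₁](t) − (I + cP)⁻¹[w₂](t)| ≤ L · max_{τ∈[0,t]} |w₁(τ) − w₂(τ)| for all w₁, w₂ ∈ C[0,T] and t ∈ [0,T], with a constant L > 0 independent of c. Let w, b ∈ C[0,T] be given with b(t) ≥ 0 for all t ∈ [0,T]. Then there exists a unique q ∈ C[0,T] such that q(t) + b(t)·P[q](t) = w(t) for all t ∈ [0,T]. -/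
open MeasureTheory Set

/-- `F` is Lipschitz in the Volterra sense relative to `G`: on each `[0,t]`, a bound for the
difference of `G`-values bounds the difference of `F`-values at `t`, with factor `K`. -/
def VolterraLipschitz (T K : ℝ) (F G : (ℝ → ℝ) → ℝ → ℝ) : Prop :=
  ∀ q₁ q₂, ContinuousOn q₁ (Icc 0 T) → ContinuousOn q₂ (Icc 0 T) → ∀ t ∈ Icc 0 T, ∀ B : ℝ,
    (∀ τ ∈ Icc 0 t, |G q₁ τ - G q₂ τ| ≤ B) → |F q₁ t - F q₂ t| ≤ K * B

theorem volterraLipschitz_of_le_iSup {T K : ℝ} (hK : 0 ≤ K) {F G : (ℝ → ℝ) → ℝ → ℝ}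
    (h : ∀ q₁ q₂, ContinuousOn q₁ (Icc 0 T) → ContinuousOn q₂ (Icc 0 T) → ∀ t ∈ Icc 0 T,
      |F q₁ t - F q₂ t| ≤ K * ⨆ τ : Icc (0 : ℝ) t, |G q₁ τ - G q₂ τ|) :
    VolterraLipschitz T K F G := by
  intro q₁ q₂ h₁ h₂ t ht B hB
  have : Nonempty (Icc (0 : ℝ) t) := ⟨⟨0, le_refl _, ht.1⟩⟩
  exact (h q₁ q₂ h₁ h₂ t ht).trans
    (mul_le_mul_of_nonneg_left (ciSup_le fun τ => hB τ τ.2) hK)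

theorem VolterraLipschitz.eqOn {T K s : ℝ} {F G : (ℝ → ℝ) → ℝ → ℝ}
    (h : VolterraLipschitz T K F G) {q₁ q₂ : ℝ → ℝ} (h₁ : ContinuousOn q₁ (Icc 0 T))
    (h₂ : ContinuousOn q₂ (Icc 0 T)) (hs : s ≤ T) (heq : EqOn (G q₁) (G q₂) (Icc 0 s)) :
    EqOn (F q₁) (F q₂) (Icc 0 s) := by
  intro t ht
  have := h q₁ q₂ h₁ h₂ t ⟨ht.1, ht.2.trans hs⟩ 0 fun τ hτ => by
    simp [heq ⟨hτ.1, hτ.2.trans ht.2⟩]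
  rw [mul_zero] at this
  exact sub_eq_zero.mp (abs_nonpos_iff.mp this)

/-- A property propagating over steps shorter than `δ` propagates from `0` to `T`. -/
theorem of_short_steps {T δ : ℝ} (hT : 0 ≤ T) (hδ : 0 < δ) {p : ℝ → Prop} (h0 : p 0)
    (hstep : ∀ s s', 0 ≤ s → s ≤ s' → s' ≤ T → s' - s < δ → p s → p s') : p T := by
  have key : ∀ n : ℕ, p (min (n * (δ / 2)) T) := by
    intro n
    induction n with
    | zero => simpa [hT] using h0
    | succ n ih =>
      refine hstep _ _ (le_min (by positivity) hT) ?_ (min_le_right _ _) ?_ ih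
      · push_cast
        gcongr
        linarith
      · push_cast
        rcases le_total (n * (δ / 2)) T with h | h
        · rw [min_eq_left h]
          linarith [min_le_left ((n + 1 : ℝ) * (δ / 2)) T]
        · rw [min_eq_right h]
          linarith [min_le_right ((n + 1 : ℝ) * (δ / 2)) T]
  obtain ⟨n, hn⟩ := exists_nat_ge (T / (δ / 2))
  have := key n
  rwa [min_eq_right ((div_le_iff₀ (by positivity)).mp hn)] at this

/-- A small variable perturbation of `I + cP` is still onto, by the contraction principle. -/
theorem exists_add_const_mul_eq_sub_mul {T M L c ε : ℝ} (hT : 0 < T)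
    {P : (ℝ → ℝ) → ℝ → ℝ} (hε : 0 ≤ ε)
    (hPmap : ∀ q, ContinuousOn q (Icc 0 T) → ContinuousOn (P q) (Icc 0 T))
    (hPlip : VolterraLipschitz T M P id)
    (hsurj : ∀ w, ContinuousOn w (Icc 0 T) →
      ∃ q, ContinuousOn q (Icc 0 T) ∧ ∀ t ∈ Icc 0 T, q t + c * P q t = w t)
    (hinvlip : VolterraLipschitz T L id fun q t => q t + c * P q t)
    (hsmall : L * (ε * M) ≤ 1 / 2) {v d : ℝ → ℝ} (hv : ContinuousOn v (Icc 0 T))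
    (hd : ContinuousOn d (Icc 0 T)) (hdε : ∀ t ∈ Icc 0 T, |d t| ≤ ε) :
    ∃ q, ContinuousOn q (Icc 0 T) ∧
      ∀ t ∈ Icc 0 T, q t + c * P q t = v t - d t * P q t := by
  have hex : ∀ q, ContinuousOn q (Icc 0 T) → ∃ r, ContinuousOn r (Icc 0 T) ∧
      ∀ t ∈ Icc 0 T, r t + c * P r t = v t - d t * P q t := fun q hq =>
    hsurj (fun t => v t - d t * P q t) (hv.sub (hd.mul (hPmap q hq)))
  let ext (q : C(Icc (0 : ℝ) T, ℝ)) : ℝ → ℝ := IccExtend hT.le q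
  have hext : ∀ q, ContinuousOn (ext q) (Icc 0 T) := fun q =>
    q.continuous.Icc_extend'.continuousOn
  choose Φ hΦc hΦ using fun q => hex (ext q) (hext q)
  let Ψ (q : C(Icc (0 : ℝ) T, ℝ)) : C(Icc (0 : ℝ) T, ℝ) :=
    ⟨(Icc 0 T).domRestrict (Φ q), (hΦc q).domRestrict⟩
  have hcontr : ContractingWith (1 / 2) Ψ := by
    refine ⟨by rw [← NNReal.coe_lt_coe]; norm_num, LipschitzWith.of_dist_le_mul fun x y => ?_⟩
    have hxy : 0 ≤ dist x y := dist_nonneg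
    refine (ContinuousMap.dist_le (by positivity)).mpr fun t => ?_
    have hP : ∀ τ ∈ Icc 0 T, |P (ext x) τ - P (ext y) τ| ≤ M * dist x y := fun τ _ =>
      hPlip _ _ (hext x) (hext y) τ ‹_› _ fun σ _ => by
        simpa [ext, IccExtend, Real.dist_eq] using
          ContinuousMap.dist_apply_le_dist (f := x) (g := y) (projIcc 0 T hT.le σ)
    have := hinvlip _ _ (hΦc x) (hΦc y) t t.2 (ε * (M * dist x y)) fun τ hτ => by
      have hτ' : τ ∈ Icc 0 T := ⟨hτ.1, hτ.2.trans t.2.2⟩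
      beta_reduce
      rw [hΦ x τ hτ', hΦ y τ hτ', sub_sub_sub_cancel_left, ← mul_sub, abs_mul, abs_sub_comm]
      exact mul_le_mul (hdε τ hτ') (hP τ hτ') (abs_nonneg _) hε
    calc dist (Ψ x t) (Ψ y t) ≤ L * (ε * (M * dist x y)) := this
      _ = L * (ε * M) * dist x y := by ring
      _ ≤ 1 / 2 * dist x y := by gcongr
      _ = _ := by norm_num
  let q := ContractingWith.fixedPoint Ψ hcontr
  have hq : Ψ q = q := hcontr.fixedPoint_isFixedPt
  have heq : EqOn (Φ q) (ext q) (Icc 0 T) := fun t ht => by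
    have h1 : Ψ q ⟨t, ht⟩ = q ⟨t, ht⟩ := by rw [hq]
    exact h1.trans (IccExtend_of_mem hT.le q ht).symm
  refine ⟨Φ q, hΦc q, fun t ht => ?_⟩
  rw [hΦ q t ht, hPlip.eqOn (hΦc q) (hext q) le_rfl heq ht]

/-- A solution for the coefficient `b` frozen after time `s` yields one for `b` frozen after a
later time `s'`, provided `b` varies little on `[s, s']`. -/
theorem exists_solution_frozen_step {T M L ε s s' : ℝ} (hT : 0 < T)
    {P : (ℝ → ℝ) → ℝ → ℝ} (hε : 0 ≤ ε)
    (hPmap : ∀ q, ContinuousOn q (Icc 0 T) → ContinuousOn (P q) (Icc 0 T))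
    (hPlip : VolterraLipschitz T M P id) {w b : ℝ → ℝ}
    (hsurj : ∀ w, ContinuousOn w (Icc 0 T) →
      ∃ q, ContinuousOn q (Icc 0 T) ∧ ∀ t ∈ Icc 0 T, q t + b s * P q t = w t)
    (hinvlip : VolterraLipschitz T L id fun q t => q t + b s * P q t)
    (hsmall : L * (ε * M) ≤ 1 / 2)
    (hw : ContinuousOn w (Icc 0 T)) (hb : ContinuousOn b (Icc 0 T))
    (hs : 0 ≤ s) (hss' : s ≤ s') (hs' : s' ≤ T) (hosc : ∀ t ∈ Icc s s', |b t - b s| ≤ ε)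
    (hq : ∃ q, ContinuousOn q (Icc 0 T) ∧
      ∀ t ∈ Icc 0 T, q t + b (min t s) * P q t = w t) :
    ∃ q, ContinuousOn q (Icc 0 T) ∧
      ∀ t ∈ Icc 0 T, q t + b (min t s') * P q t = w t := by
  obtain ⟨q₀, hq₀, hsol₀⟩ := hq
  have hbmin : ∀ r, 0 ≤ r → r ≤ T → ContinuousOn (fun t => b (min t r)) (Icc 0 T) :=
    fun r hr hrT => hb.comp (by fun_prop) fun t ht => ⟨le_min ht.1 hr, (min_le_right _ _).trans hrT⟩
  have hbs := hbmin s hs (hss'.trans hs')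
  obtain ⟨q, hqc, hsol⟩ := exists_add_const_mul_eq_sub_mul hT hε hPmap hPlip hsurj hinvlip
    hsmall (v := fun t => w t + (b s - b (min t s)) * P q₀ t)
    (d := fun t => b (min t s') - b (min t s))
    (hw.add ((continuousOn_const.sub hbs).mul (hPmap q₀ hq₀)))
    ((hbmin s' (hs.trans hss') hs').sub hbs) fun t ht => by
      rcases le_total t s with h | h
      · simpa [min_eq_left h, min_eq_left (h.trans hss')] using hε
      · rw [min_eq_right h]
        exact hosc _ ⟨le_min h hss', min_le_right _ _⟩
  have heq : EqOn q q₀ (Icc 0 s) := hinvlip.eqOn hqc hq₀ (hss'.trans hs') fun t ht => by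
    have htT : t ∈ Icc 0 T := ⟨ht.1, ht.2.trans (hss'.trans hs')⟩
    have h₁ := hsol t htT
    have h₂ := hsol₀ t htT
    simp only [min_eq_left ht.2, min_eq_left (ht.2.trans hss')] at h₁ h₂
    linear_combination h₁ - h₂
  have hPeq : EqOn (P q) (P q₀) (Icc 0 s) := hPlip.eqOn hqc hq₀ (hss'.trans hs') heq
  refine ⟨q, hqc, fun t ht => ?_⟩
  have h₁ := hsol t ht
  rcases le_total t s with h | h
  · rw [← hPeq ⟨ht.1, h⟩] at h₁
    linear_combination h₁
  · simp only [min_eq_right h] at h₁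
    linear_combination h₁

/-- Two solutions agreeing on `[0, s]` agree on `[0, s']` if `b` varies little on `[s, s']`. -/
theorem eqOn_solutions_step {T M L ε s s' : ℝ} {P : (ℝ → ℝ) → ℝ → ℝ} (hM : 0 ≤ M)
    (hε : 0 ≤ ε) (hPlip : VolterraLipschitz T M P id) {w b : ℝ → ℝ}
    (hinvlip : VolterraLipschitz T L id fun q t => q t + b s * P q t)
    (hsmall : L * (ε * M) ≤ 1 / 2)
    (hs : 0 ≤ s) (hss' : s ≤ s') (hs' : s' ≤ T) (hosc : ∀ t ∈ Icc s s', |b t - b s| ≤ ε)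
    {q q' : ℝ → ℝ} (hq : ContinuousOn q (Icc 0 T)) (hq' : ContinuousOn q' (Icc 0 T))
    (hsol : ∀ t ∈ Icc 0 T, q t + b t * P q t = w t)
    (hsol' : ∀ t ∈ Icc 0 T, q' t + b t * P q' t = w t)
    (heq : EqOn q q' (Icc 0 s)) : EqOn q q' (Icc 0 s') := by
  have hsub : Icc 0 s' ⊆ Icc 0 T := Icc_subset_Icc_right hs'
  have hPeq : EqOn (P q) (P q') (Icc 0 s) := hPlip.eqOn hq hq' (hss'.trans hs') heq
  obtain ⟨t₀, ht₀, hmax⟩ := isCompact_Icc.exists_isMaxOn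
    (nonempty_Icc.mpr (hs.trans hss')) ((hq.sub hq').abs.mono hsub)
  set B := |q t₀ - q' t₀| with hB
  have hBnn : 0 ≤ B := abs_nonneg _
  have hle : ∀ t ∈ Icc 0 s', |q t - q' t| ≤ B := fun t ht => hmax ht
  have hbound : B ≤ L * (ε * (M * B)) :=
    hinvlip q q' hq hq' t₀ (hsub ht₀) _ fun τ hτ => by
      have hτ' : τ ∈ Icc 0 s' := ⟨hτ.1, hτ.2.trans ht₀.2⟩
      have hdiff : q τ + b s * P q τ - (q' τ + b s * P q' τ) =
          -((b τ - b s) * (P q τ - P q' τ)) := by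
        linear_combination hsol τ (hsub hτ') - hsol' τ (hsub hτ')
      rw [hdiff, abs_neg, abs_mul]
      rcases le_total τ s with h | h
      · rw [hPeq ⟨hτ.1, h⟩, sub_self, abs_zero, mul_zero]
        positivity
      · exact mul_le_mul (hosc τ ⟨h, hτ'.2⟩)
          (hPlip q q' hq hq' τ (hsub hτ') B fun σ hσ => hle σ ⟨hσ.1, hσ.2.trans hτ'.2⟩)
          (abs_nonneg _) hε
  have hB0 : B ≤ 0 := by nlinarith
  exact fun t ht => sub_eq_zero.mp (abs_nonpos_iff.mp ((hle t ht).trans hB0))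

/-- Lemma 1: existence and uniqueness for `q + b·P[q] = w` with a Volterra-Lipschitz
hysteresis operator `P` on `C[0,T]` such that `I + cP` has a uniformly Lipschitz
inverse for every constant `c ≥ 0`. -/
theorem stmt_0 (T : ℝ) (hT : 0 < T)
    (P : (ℝ → ℝ) → (ℝ → ℝ)) (M L : ℝ) (hM : 0 < M) (hL : 0 < L)
    -- P maps C[0,T] into C[0,T]
    (hPmap : ∀ q, ContinuousOn q (Icc 0 T) → ContinuousOn (P q) (Icc 0 T))
    -- Lipschitz continuity of P in the Volterra sense
    (hPlip : ∀ q₁ q₂, ContinuousOn q₁ (Icc 0 T) → ContinuousOn q₂ (Icc 0 T) →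
      ∀ t ∈ Icc 0 T, |P q₁ t - P q₂ t| ≤ M * ⨆ τ : Icc (0:ℝ) t, |q₁ τ - q₂ τ|)
    -- for every c ≥ 0, I + cP is onto C[0,T]
    (hsurj : ∀ c : ℝ, 0 ≤ c → ∀ w, ContinuousOn w (Icc 0 T) →
      ∃ q, ContinuousOn q (Icc 0 T) ∧ ∀ t ∈ Icc 0 T, q t + c * P q t = w t)
    -- the inverse of I + cP is Lipschitz with constant L independent of c
    (hinvlip : ∀ c : ℝ, 0 ≤ c → ∀ q₁ q₂, ContinuousOn q₁ (Icc 0 T) →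
      ContinuousOn q₂ (Icc 0 T) → ∀ t ∈ Icc 0 T,
      |q₁ t - q₂ t| ≤
        L * ⨆ τ : Icc (0:ℝ) t, |(q₁ τ + c * P q₁ τ) - (q₂ τ + c * P q₂ τ)|)
    (w b : ℝ → ℝ) (hw : ContinuousOn w (Icc 0 T)) (hb : ContinuousOn b (Icc 0 T))
    (hbnn : ∀ t ∈ Icc 0 T, 0 ≤ b t) :
    ∃ q, (ContinuousOn q (Icc 0 T) ∧ ∀ t ∈ Icc 0 T, q t + b t * P q t = w t) ∧
      ∀ q', ContinuousOn q' (Icc 0 T) → (∀ t ∈ Icc 0 T, q' t + b t * P q' t = w t) →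
        EqOn q q' (Icc 0 T) := by
  have hPV : VolterraLipschitz T M P id := volterraLipschitz_of_le_iSup hM.le hPlip
  have hIV : ∀ c, 0 ≤ c → VolterraLipschitz T L id fun q t => q t + c * P q t := fun c hc =>
    volterraLipschitz_of_le_iSup hL.le (hinvlip c hc)
  obtain ⟨ε, hε, hsmall⟩ : ∃ ε : ℝ, 0 < ε ∧ L * (ε * M) ≤ 1 / 2 :=
    ⟨1 / (2 * L * M), by positivity, le_of_eq (by field_simp)⟩
  obtain ⟨δ, hδ, hbδ⟩ := Metric.uniformContinuousOn_iff.mp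
    (isCompact_Icc.uniformContinuousOn_of_continuous hb) ε hε
  have hosc : ∀ s s', 0 ≤ s → s ≤ s' → s' ≤ T → s' - s < δ →
      ∀ t ∈ Icc s s', |b t - b s| ≤ ε := fun s s' hs hss' hs' hlt t ht =>
    (hbδ t ⟨hs.trans ht.1, ht.2.trans hs'⟩ s ⟨hs, hss'.trans hs'⟩ (by
      rw [Real.dist_eq, abs_of_nonneg (sub_nonneg.mpr ht.1)]
      linarith [ht.2])).le
  have hex : ∃ q, ContinuousOn q (Icc 0 T) ∧
      ∀ t ∈ Icc 0 T, q t + b (min t T) * P q t = w t := by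
    refine of_short_steps (p := fun s => ∃ q, ContinuousOn q (Icc 0 T) ∧
      ∀ t ∈ Icc 0 T, q t + b (min t s) * P q t = w t) hT.le hδ ?_ ?_
    · obtain ⟨q, hq, hsol⟩ := hsurj (b 0) (hbnn 0 ⟨le_rfl, hT.le⟩) w hw
      exact ⟨q, hq, fun t ht => by rw [min_eq_right ht.1, hsol t ht]⟩
    · intro s s' hs hss' hs' hlt
      have hbs := hbnn s ⟨hs, hss'.trans hs'⟩
      exact exists_solution_frozen_step hT hε.le hPmap hPV (hsurj _ hbs) (hIV _ hbs)
        hsmall hw hb hs hss' hs' (hosc s s' hs hss' hs' hlt)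
  obtain ⟨q, hq, hsol⟩ := hex
  replace hsol : ∀ t ∈ Icc 0 T, q t + b t * P q t = w t := fun t ht => by
    simpa [min_eq_left ht.2] using hsol t ht
  refine ⟨q, ⟨hq, hsol⟩, fun q' hq' hsol' => ?_⟩
  refine of_short_steps (p := fun s => EqOn q q' (Icc 0 s)) hT.le hδ ?_ ?_
  · have h0 : (0 : ℝ) ∈ Icc 0 T := ⟨le_rfl, hT.le⟩
    refine (hIV _ (hbnn 0 h0)).eqOn hq hq' hT.le fun t ht => ?_
    obtain rfl : t = 0 := le_antisymm ht.2 ht.1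
    exact (hsol 0 h0).trans (hsol' 0 h0).symm
  · intro s s' hs hss' hs' hlt
    exact eqOn_solutions_step hM.le hε.le hPV (hIV _ (hbnn s ⟨hs, hss'.trans hs'⟩)) hsmall
      hs hss' hs' (hosc s s' hs hss' hs' hlt) hq hq' hsol hsol'
end

section
/- Let T > 0, let r₂ > r₁ > 0, let q : [0,T] → ℝ be absolutely continuous, and let ξ_{r₁} and ξ_{r₂} be solutions of the play variational inequality with input q and thresholds r₁ and r₂ respectively. Then |ξ_{r₁}(t) − ξ_{r₂}(t)| ≤ r₂ − r₁ for all t ∈ [0,T], and for a.e. t ∈ (0,T) and every z ∈ [−1,1] one has ξ_{r₂}'(t)·(ξ_{r₁}(t) − ξ_{r₂}(t) − (r₂ − r₁)z) ≥ 0; that is, ξ_{r₂} satisfies the two variational conditions of the play with threshold r₂ − r₁ and input ξ_{r₁}. -/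
open MeasureTheory Set

/-- `q` is absolutely continuous on `[0,T]` with a.e. derivative `q'`,
encoded via the fundamental theorem of calculus. -/
def IsACOn (T : ℝ) (q q' : ℝ → ℝ) : Prop :=
  IntegrableOn q' (Icc 0 T) ∧ ∀ t ∈ Icc 0 T, q t = q 0 + ∫ τ in (0:ℝ)..t, q' τ

/-- `ξ` (with a.e. derivative `ξ'`) solves the play variational inequality
with threshold `r` and input `q` on `[0,T]`:
(i) `|q - ξ| ≤ r` on `[0,T]`, (ii) `ξ'(t)(q(t) - ξ(t) - r z) ≥ 0` for a.e. `t`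
and all `z ∈ [-1,1]`, (iii) `ξ(0) = max{q(0) - r, min{0, q(0) + r}}`. -/
def IsPlaySol (T r : ℝ) (q ξ ξ' : ℝ → ℝ) : Prop :=
  IsACOn T ξ ξ' ∧
  (∀ t ∈ Icc 0 T, |q t - ξ t| ≤ r) ∧
  (∀ᵐ t ∂(volume.restrict (Ioo 0 T)),
    ∀ z ∈ Icc (-1:ℝ) 1, ξ' t * (q t - ξ t - r * z) ≥ 0) ∧
  ξ 0 = max (q 0 - r) (min 0 (q 0 + r))

theorem IsACOn.continuousOn {T : ℝ} {f f' : ℝ → ℝ} (hf : IsACOn T f f') (hT : 0 ≤ T) :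
    ContinuousOn f (Icc 0 T) := by
  have h := intervalIntegral.continuousOn_primitive_interval (μ := volume) (f := f') (a := 0)
    (b := T) (by rw [uIcc_of_le hT]; exact hf.1)
  rw [uIcc_of_le hT] at h
  exact (continuousOn_const.add h).congr hf.2

theorem IsACOn.intervalIntegrable {T : ℝ} {f f' : ℝ → ℝ} (hf : IsACOn T f f') {s t : ℝ}
    (hs : s ∈ Icc 0 T) (ht : t ∈ Icc 0 T) : IntervalIntegrable f' volume s t :=
  (hf.1.mono_set (uIcc_subset_Icc hs ht)).intervalIntegrable

theorem IsACOn.sub_eq_integral {T : ℝ} {f f' : ℝ → ℝ} (hf : IsACOn T f f') {s t : ℝ}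
    (hs : s ∈ Icc 0 T) (ht : t ∈ Icc 0 T) : f t - f s = ∫ τ in s..t, f' τ := by
  have h0 : (0 : ℝ) ∈ Icc 0 T := ⟨le_rfl, hs.1.trans hs.2⟩
  rw [hf.2 t ht, hf.2 s hs, add_sub_add_left_eq_sub,
    intervalIntegral.integral_interval_sub_left (hf.intervalIntegrable h0 ht)
      (hf.intervalIntegrable h0 hs)]

theorem IsACOn.sub {T : ℝ} {f f' g g' : ℝ → ℝ} (hf : IsACOn T f f') (hg : IsACOn T g g') :
    IsACOn T (fun t => f t - g t) (fun t => f' t - g' t) := by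
  refine ⟨hf.1.sub hg.1, fun t ht => ?_⟩
  have h0 : (0 : ℝ) ∈ Icc 0 T := ⟨le_rfl, ht.1.trans ht.2⟩
  rw [intervalIntegral.integral_sub (hf.intervalIntegrable h0 ht) (hg.intervalIntegrable h0 ht),
    ← hf.sub_eq_integral h0 ht, ← hg.sub_eq_integral h0 ht]
  ring

/-- An absolutely continuous function that starts below a level `c` and is nonincreasing above
that level stays below it. -/
theorem IsACOn.le_of_deriv_nonpos_above {T c : ℝ} {f f' : ℝ → ℝ} (hf : IsACOn T f f')
    (h0 : f 0 ≤ c) (h : ∀ᵐ t ∂(volume.restrict (Ioo 0 T)), c < f t → f' t ≤ 0)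
    {t : ℝ} (ht : t ∈ Icc 0 T) : f t ≤ c := by
  by_contra! hct
  have hcont : ContinuousOn f (Icc 0 t) :=
    (hf.continuousOn (ht.1.trans ht.2)).mono (Icc_subset_Icc_right ht.2)
  have hcomp : IsCompact (Icc 0 t ∩ f ⁻¹' Iic c) :=
    isCompact_Icc.of_isClosed_subset (hcont.preimage_isClosed_of_isClosed isClosed_Icc isClosed_Iic)
      inter_subset_left
  obtain ⟨s, ⟨hs, hsc⟩, hmax⟩ := hcomp.exists_isGreatest ⟨0, ⟨le_rfl, ht.1⟩, h0⟩
  have hsc : f s ≤ c := hsc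
  have hint : ∫ τ in s..t, f' τ ≤ 0 := by
    rw [intervalIntegral.integral_of_le hs.2, integral_Ioc_eq_integral_Ioo]
    refine integral_nonpos_of_ae ?_
    filter_upwards [ae_restrict_of_ae_restrict_of_subset (Ioo_subset_Ioo hs.1 ht.2) h,
      ae_restrict_mem measurableSet_Ioo] with τ hτ hmem
    refine hτ ?_
    by_contra! hle
    exact absurd (hmax ⟨⟨hs.1.trans hmem.1.le, hmem.2.le⟩, hle⟩) (not_le.mpr hmem.1)
  rw [← hf.sub_eq_integral ⟨hs.1, hs.2.trans ht.2⟩ ht] at hint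
  linarith

/-- A play can only decrease off the upper threshold and only increase off the lower one. -/
theorem IsPlaySol.ae_sign {T r : ℝ} {q ξ ξ' : ℝ → ℝ} (h : IsPlaySol T r q ξ ξ') :
    ∀ᵐ t ∂(volume.restrict (Ioo 0 T)),
      (q t - ξ t < r → ξ' t ≤ 0) ∧ (-r < q t - ξ t → 0 ≤ ξ' t) := by
  filter_upwards [h.2.2.1] with t ht
  have h1 := ht 1 (by norm_num)
  have h2 := ht (-1) (by norm_num)
  constructor <;> intro h3 <;> nlinarith

/-- Lemma 2 (Brokate's identity): if `ξ₁` and `ξ₂` are play solutions with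
thresholds `r₁ < r₂` and the same input `q`, then `ξ₂` satisfies the two
variational conditions of the play with threshold `r₂ - r₁` and input `ξ₁`. -/
theorem stmt_1 (T r₁ r₂ : ℝ) (hT : 0 < T) (hr₁ : 0 < r₁) (hr₁₂ : r₁ < r₂)
    (q q' ξ₁ ξ₁' ξ₂ ξ₂' : ℝ → ℝ) (hq : IsACOn T q q')
    (h₁ : IsPlaySol T r₁ q ξ₁ ξ₁') (h₂ : IsPlaySol T r₂ q ξ₂ ξ₂') :
    (∀ t ∈ Icc 0 T, |ξ₁ t - ξ₂ t| ≤ r₂ - r₁) ∧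
    (∀ᵐ t ∂(volume.restrict (Ioo 0 T)),
      ∀ z ∈ Icc (-1:ℝ) 1, ξ₂' t * (ξ₁ t - ξ₂ t - (r₂ - r₁) * z) ≥ 0) := by
  obtain ⟨hac₁, hb₁, -, hi₁⟩ := id h₁
  obtain ⟨hac₂, hb₂, -, hi₂⟩ := id h₂
  have hinit : ξ₁ 0 - ξ₂ 0 ≤ r₂ - r₁ ∧ ξ₂ 0 - ξ₁ 0 ≤ r₂ - r₁ := by
    rw [hi₁, hi₂]
    constructor <;> grind
  have hdiff : ∀ t ∈ Icc 0 T, |ξ₁ t - ξ₂ t| ≤ r₂ - r₁ := by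
    intro t ht
    refine abs_sub_le_iff.mpr ⟨(hac₁.sub hac₂).le_of_deriv_nonpos_above hinit.1 ?_ ht,
      (hac₂.sub hac₁).le_of_deriv_nonpos_above hinit.2 ?_ ht⟩
    all_goals
      filter_upwards [h₁.ae_sign, h₂.ae_sign, ae_restrict_mem measurableSet_Ioo]
        with τ hs₁ hs₂ hτ hlt
      have hτ₁ := abs_le.mp (hb₁ τ (Ioo_subset_Icc_self hτ))
      have hτ₂ := abs_le.mp (hb₂ τ (Ioo_subset_Icc_self hτ))
    · linarith [hs₁.1 (by linarith), hs₂.2 (by linarith)]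
    · linarith [hs₁.2 (by linarith), hs₂.1 (by linarith)]
  refine ⟨hdiff, ?_⟩
  filter_upwards [h₂.ae_sign, ae_restrict_mem measurableSet_Ioo] with t hs ht z hz
  have ht₁ := abs_le.mp (hb₁ t (Ioo_subset_Icc_self ht))
  have hzl : -(r₂ - r₁) ≤ (r₂ - r₁) * z := by nlinarith [hz.1]
  have hzu : (r₂ - r₁) * z ≤ r₂ - r₁ := by nlinarith [hz.2]
  rcases lt_trichotomy (ξ₂' t) 0 with hneg | hzero | hpos
  · have hle : q t - ξ₂ t ≤ -r₂ := not_lt.mp fun hlt => hneg.not_ge (hs.2 hlt)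
    exact mul_nonneg_of_nonpos_of_nonpos hneg.le (by linarith)
  · simp [hzero]
  · have hge : r₂ ≤ q t - ξ₂ t := not_lt.mp fun hlt => hpos.not_ge (hs.1 hlt)
    exact mul_nonneg hpos.le (by linarith)
end

section
/- Let T > 0, r > 0, let q : [0,T] → ℝ be absolutely continuous, and let ξ₁, ξ₂ : [0,T] → ℝ be absolutely continuous functions such that for i = 1,2: |q(t) − ξ_i(t)| ≤ r for all t ∈ [0,T] and ξ_i'(t)·(q(t) − ξ_i(t) − rz) ≥ 0 for a.e. t ∈ (0,T) and every z ∈ [−1,1]. If ξ₁(0) = ξ₂(0), then ξ₁(t) = ξ₂(t) for all t ∈ [0,T]. -/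
open MeasureTheory Set

/-- If the primitive `F` of `f` satisfies `F' F ≤ 0` almost everywhere, then `F` vanishes at the
right endpoint. -/
theorem intervalIntegral_eq_zero_of_ae_mul_nonpos {f : ℝ → ℝ} {a b : ℝ} (hab : a ≤ b)
    (hf : IntervalIntegrable f volume a b)
    (h : ∀ᵐ x ∂(volume.restrict (Ioo a b)), f x * ∫ τ in a..x, f τ ≤ 0) :
    ∫ τ in a..b, f τ = 0 := by
  have hF := hf.absolutelyContinuousOnInterval_intervalIntegral (c := a) left_mem_uIcc
  have hparts := hF.integral_deriv_mul_eq_sub hF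
  have hderiv : ∀ᵐ x ∂(volume.restrict (Ioo a b)),
      deriv (fun y ↦ ∫ τ in a..y, f τ) x = f x := by
    refine (ae_restrict_iff' measurableSet_Ioo).2 ?_
    filter_upwards [hf.ae_hasDerivAt_integral] with x hx hxab
    exact (hx (uIcc_of_le hab ▸ Ioo_subset_Icc_self hxab) a left_mem_uIcc).deriv
  have hle : ∫ x in a..b, (deriv (fun y ↦ ∫ τ in a..y, f τ) x * (∫ τ in a..x, f τ) +
      (∫ τ in a..x, f τ) * deriv (fun y ↦ ∫ τ in a..y, f τ) x) ≤ 0 := by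
    rw [intervalIntegral.integral_of_le hab, integral_Ioc_eq_integral_Ioo]
    refine integral_nonpos_of_ae ?_
    filter_upwards [h, hderiv] with x hx hdx
    simp only [hdx, Pi.zero_apply]
    linarith [mul_comm (f x) (∫ τ in a..x, f τ)]
  simp only [intervalIntegral.integral_same, mul_zero, sub_zero] at hparts
  exact mul_self_eq_zero.1 (le_antisymm (hparts ▸ hle) (mul_self_nonneg _))

/-- A point `x` with `|c - x| ≤ r` is of the form `c - r z` with `z ∈ [-1,1]`. -/
theorem exists_mem_Icc_sub_mul_eq {r c x : ℝ} (hr : 0 < r) (h : |c - x| ≤ r) :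
    ∃ z ∈ Icc (-1 : ℝ) 1, c - r * z = x := by
  refine ⟨(c - x) / r, ?_, by field_simp; ring⟩
  rw [mem_Icc, ← abs_le, abs_div, abs_of_pos hr]
  exact (div_le_one hr).2 h

/-- Uniqueness of solutions of the play variational inequality with the same
initial value: conditions (i) and (ii) together with `ξ₁(0) = ξ₂(0)`
imply `ξ₁ = ξ₂` on `[0,T]`. -/
theorem stmt_8 (T r : ℝ) (hT : 0 < T) (hr : 0 < r)
    (q q' ξ₁ ξ₁' ξ₂ ξ₂' : ℝ → ℝ) (hq : IsACOn T q q')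
    (hac₁ : IsACOn T ξ₁ ξ₁') (hac₂ : IsACOn T ξ₂ ξ₂')
    (hbd₁ : ∀ t ∈ Icc 0 T, |q t - ξ₁ t| ≤ r)
    (hbd₂ : ∀ t ∈ Icc 0 T, |q t - ξ₂ t| ≤ r)
    (hvi₁ : ∀ᵐ t ∂(volume.restrict (Ioo 0 T)),
      ∀ z ∈ Icc (-1:ℝ) 1, ξ₁' t * (q t - ξ₁ t - r * z) ≥ 0)
    (hvi₂ : ∀ᵐ t ∂(volume.restrict (Ioo 0 T)),
      ∀ z ∈ Icc (-1:ℝ) 1, ξ₂' t * (q t - ξ₂ t - r * z) ≥ 0)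
    (h0 : ξ₁ 0 = ξ₂ 0) :
    ∀ t ∈ Icc 0 T, ξ₁ t = ξ₂ t := by
  intro t ht
  have hsub : Icc 0 t ⊆ Icc 0 T := Icc_subset_Icc_right ht.2
  have hint : ∀ {f : ℝ → ℝ}, IntegrableOn f (Icc 0 T) → ∀ x ∈ Icc 0 t,
      IntervalIntegrable f volume 0 x := fun hf x hx ↦
    (intervalIntegrable_iff_integrableOn_Icc_of_le hx.1).2
      (hf.mono_set (Icc_subset_Icc_right (hsub hx).2))
  have hdiff : ∀ x ∈ Icc 0 t, ∫ τ in (0:ℝ)..x, (ξ₁' τ - ξ₂' τ) = ξ₁ x - ξ₂ x := fun x hx ↦ by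
    rw [intervalIntegral.integral_sub (hint hac₁.1 x hx) (hint hac₂.1 x hx),
      hac₁.2 x (hsub hx), hac₂.2 x (hsub hx), h0]
    ring
  have htt : t ∈ Icc 0 t := right_mem_Icc.2 ht.1
  rw [← sub_eq_zero, ← hdiff t htt]
  refine intervalIntegral_eq_zero_of_ae_mul_nonpos ht.1
    ((hint hac₁.1 t htt).sub (hint hac₂.1 t htt)) ?_
  have hIoo : Ioo 0 t ⊆ Ioo 0 T := Ioo_subset_Ioo_right ht.2
  filter_upwards [ae_restrict_of_ae_restrict_of_subset hIoo hvi₁,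
    ae_restrict_of_ae_restrict_of_subset hIoo hvi₂, ae_restrict_mem measurableSet_Ioo]
    with x h₁ h₂ hx
  have hx' : x ∈ Icc 0 t := Ioo_subset_Icc_self hx
  obtain ⟨z₁, hz₁, hξ₁⟩ := exists_mem_Icc_sub_mul_eq hr (hbd₁ x (hsub hx'))
  obtain ⟨z₂, hz₂, hξ₂⟩ := exists_mem_Icc_sub_mul_eq hr (hbd₂ x (hsub hx'))
  have hv₁ := h₁ z₂ hz₂
  have hv₂ := h₂ z₁ hz₁
  rw [sub_right_comm, hξ₂] at hv₁
  rw [sub_right_comm, hξ₁] at hv₂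
  rw [hdiff x hx']
  linarith
end

section
/- Let T > 0, r > 0, let g : ℝ → ℝ be nondecreasing and Lipschitz continuous, let q₁, q₂ : [0,T] → ℝ be absolutely continuous, and for i = 1,2 let ξ^i be a solution of the play variational inequality with threshold r and input q_i. Then for a.e. t ∈ (0,T) one has (d/dt)(g(ξ¹(t)) − g(ξ²(t))) · ((q₁(t) − q₂(t)) − (ξ¹(t) − ξ²(t))) ≥ 0. -/
open MeasureTheory Set

open Filter Topology

lemma IsACOn.ae_hasDerivAt {T : ℝ} {ξ ξ' : ℝ → ℝ} (hT : 0 < T) (h : IsACOn T ξ ξ') :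
    ∀ᵐ t ∂(volume.restrict (Ioo 0 T)), HasDerivAt ξ (ξ' t) t := by
  obtain ⟨hint, hftc⟩ := h
  have hI : IntervalIntegrable ξ' volume 0 T :=
    (intervalIntegrable_iff_integrableOn_Icc_of_le hT.le).2 hint
  rw [ae_restrict_iff' measurableSet_Ioo]
  filter_upwards [hI.ae_hasDerivAt_integral] with t ht htT
  have hd := (ht (by rw [uIcc_of_le hT.le]; exact Ioo_subset_Icc_self htT) 0 (by simp)).const_add
    (ξ 0)
  refine hd.congr_of_eventuallyEq ?_
  filter_upwards [Ioo_mem_nhds htT.1 htT.2] with s hs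
  exact hftc s (Ioo_subset_Icc_self hs)

/-- To first order, a monotone `K`-Lipschitz function does not decrease along a curve moving
with nonnegative velocity. -/
lemma Monotone.eventually_sub_le_comp_of_hasDerivAt {g ξ : ℝ → ℝ} {K : NNReal} {a t ε : ℝ}
    (hg : Monotone g) (hK : LipschitzWith K g) (hξ : HasDerivAt ξ a t) (ha : 0 ≤ a)
    (hε : 0 < ε) : ∀ᶠ s in 𝓝[>] t, g (ξ t) - K * (ε * (s - t)) ≤ g (ξ s) := by
  have hd := (hasDerivAt_iff_isLittleO.1 hξ).def hε
  filter_upwards [hd.filter_mono nhdsWithin_le_nhds, self_mem_nhdsWithin] with s hs hts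
  have hst : 0 < s - t := sub_pos.2 hts
  rw [Real.norm_eq_abs, Real.norm_eq_abs, abs_of_pos hst, smul_eq_mul] at hs
  have hlow : ξ t - ε * (s - t) ≤ ξ s := by
    nlinarith [(abs_le.1 hs).1, mul_nonneg hst.le ha]
  have hlip := hK.dist_le_mul (ξ t) (ξ t - ε * (s - t))
  rw [Real.dist_eq, Real.dist_eq, sub_sub_cancel, abs_of_pos (mul_pos hε hst)] at hlip
  linarith [hg hlow, (abs_le.1 hlip).2]

/-- The reverse first-order estimate, along a curve moving with nonpositive velocity. -/
lemma Monotone.eventually_comp_le_add_of_hasDerivAt {g ξ : ℝ → ℝ} {K : NNReal} {a t ε : ℝ}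
    (hg : Monotone g) (hK : LipschitzWith K g) (hξ : HasDerivAt ξ a t) (ha : a ≤ 0)
    (hε : 0 < ε) : ∀ᶠ s in 𝓝[>] t, g (ξ s) ≤ g (ξ t) + K * (ε * (s - t)) := by
  have hg' : Monotone fun x => -g (-x) := fun x y hxy => neg_le_neg (hg (neg_le_neg hxy))
  have hK' : LipschitzWith K fun x => -g (-x) := by
    refine LipschitzWith.of_dist_le_mul fun x y => ?_
    simpa only [dist_neg_neg] using hK.dist_le_mul (-x) (-y)
  filter_upwards [hg'.eventually_sub_le_comp_of_hasDerivAt hK' hξ.neg (neg_nonneg.2 ha) hε]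
    with s hs
  simp only [Pi.neg_apply, neg_neg] at hs
  linarith

/-- If `ξ₁` moves up and `ξ₂` moves down, then any derivative of `g ∘ ξ₁ - g ∘ ξ₂` is
nonnegative; no differentiability of `g` is needed. -/
lemma Monotone.nonneg_of_hasDerivAt_comp_sub_comp {g ξ₁ ξ₂ : ℝ → ℝ} {K : NNReal} {a b D t : ℝ}
    (hg : Monotone g) (hK : LipschitzWith K g) (h₁ : HasDerivAt ξ₁ a t) (h₂ : HasDerivAt ξ₂ b t)
    (ha : 0 ≤ a) (hb : b ≤ 0) (hD : HasDerivAt (fun s => g (ξ₁ s) - g (ξ₂ s)) D t) :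
    0 ≤ D := by
  have key : ∀ ε : ℝ, 0 < ε → 0 ≤ D + ε * (1 + 2 * K) := by
    intro ε hε
    have hd := ((hasDerivAt_iff_isLittleO.1 hD).def hε).filter_mono
      (nhdsWithin_le_nhds (s := Ioi t))
    obtain ⟨s, hs, hs₁, hs₂, hts⟩ := (hd.and
      ((hg.eventually_sub_le_comp_of_hasDerivAt hK h₁ ha hε).and
        ((hg.eventually_comp_le_add_of_hasDerivAt hK h₂ hb hε).and self_mem_nhdsWithin))).exists
    have hst : 0 < s - t := sub_pos.2 hts
    rw [Real.norm_eq_abs, Real.norm_eq_abs, abs_of_pos hst, smul_eq_mul] at hs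
    refine nonneg_of_mul_nonneg_right (b := D + ε * (1 + 2 * K)) ?_ hst
    linarith [(abs_le.1 hs).2]
  by_contra! hneg
  have hc : (0 : ℝ) < 1 + 2 * K := by positivity
  have := key (-D / (2 * (1 + 2 * K))) (by apply div_pos <;> linarith)
  have heq : -D / (2 * (1 + 2 * K)) * (1 + 2 * K) = -D / 2 := by field_simp
  linarith

/-- Inequality (xe20): for a nondecreasing Lipschitz `g` and plays `ξ¹, ξ²`
with the same threshold `r` and inputs `q₁, q₂`, wherever the derivative
`D = (d/dt)(g(ξ¹) - g(ξ²))(t)` exists (which is a.e.) one has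
`D·((q₁ - q₂) - (ξ¹ - ξ²))(t) ≥ 0`. -/
theorem stmt_11 (T r : ℝ) (hT : 0 < T) (hr : 0 < r)
    (g : ℝ → ℝ) (hgmono : Monotone g) (hglip : ∃ K : NNReal, LipschitzWith K g)
    (q₁ q₂ q₁' q₂' ξ₁ ξ₁' ξ₂ ξ₂' : ℝ → ℝ)
    (hq₁ : IsACOn T q₁ q₁') (hq₂ : IsACOn T q₂ q₂')
    (h₁ : IsPlaySol T r q₁ ξ₁ ξ₁') (h₂ : IsPlaySol T r q₂ ξ₂ ξ₂') :
    ∀ᵐ t ∂(volume.restrict (Ioo 0 T)), ∀ D : ℝ,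
      HasDerivAt (fun s => g (ξ₁ s) - g (ξ₂ s)) D t →
        D * ((q₁ t - q₂ t) - (ξ₁ t - ξ₂ t)) ≥ 0 := by
  obtain ⟨K, hK⟩ := hglip
  obtain ⟨hac₁, hb₁, hv₁, -⟩ := h₁
  obtain ⟨hac₂, hb₂, hv₂, -⟩ := h₂
  filter_upwards [hac₁.ae_hasDerivAt hT, hac₂.ae_hasDerivAt hT, hv₁, hv₂,
    ae_restrict_mem measurableSet_Ioo] with t hd₁ hd₂ hz₁ hz₂ ht D hD
  have hr₁ := abs_le.1 (hb₁ t (Ioo_subset_Icc_self ht))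
  have hr₂ := abs_le.1 (hb₂ t (Ioo_subset_Icc_self ht))
  have hup₁ := hz₁ (-1) (by simp)
  have hup₂ := hz₂ (-1) (by simp)
  have hdown₁ := hz₁ 1 (by simp)
  have hdown₂ := hz₂ 1 (by simp)
  rcases lt_trichotomy (q₁ t - ξ₁ t) (q₂ t - ξ₂ t) with h | h | h
  · have ha : ξ₁' t ≤ 0 := by
      by_contra! hc
      nlinarith [mul_pos hc (show 0 < r - (q₁ t - ξ₁ t) by linarith)]
    have hb : 0 ≤ ξ₂' t := by
      by_contra! hc
      nlinarith [mul_pos (neg_pos.2 hc) (show 0 < q₂ t - ξ₂ t + r by linarith)]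
    have hD' : HasDerivAt (fun s => g (ξ₂ s) - g (ξ₁ s)) (-D) t := by
      simpa only [neg_sub] using hD.fun_neg
    have := hgmono.nonneg_of_hasDerivAt_comp_sub_comp hK hd₂ hd₁ hb ha hD'
    exact mul_nonneg_of_nonpos_of_nonpos (by linarith) (by linarith)
  · rw [show (q₁ t - q₂ t) - (ξ₁ t - ξ₂ t) = 0 by linarith, mul_zero]
  · have ha : 0 ≤ ξ₁' t := by
      by_contra! hc
      nlinarith [mul_pos (neg_pos.2 hc) (show 0 < q₁ t - ξ₁ t + r by linarith)]
    have hb : ξ₂' t ≤ 0 := by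
      by_contra! hc
      nlinarith [mul_pos hc (show 0 < r - (q₂ t - ξ₂ t) by linarith)]
    have := hgmono.nonneg_of_hasDerivAt_comp_sub_comp hK hd₁ hd₂ ha hb hD
    exact mul_nonneg this (by linarith)
end
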